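/- Let n be a positive integer and let α < p_S(n) be a real number. There is a constant C = C(n, α) > 0 such that for every x₀ ∈ ℝⁿ, every R > 0, and every positive solution u of Δu + u^α = 0 on B(x₀, 2R), the Harnack inequality sup_{B(x₀,R)} u ≤ C · inf_{B(x₀,R)} u holds. -/

import Mathlib

open Set Metric

/-- Euclidean space ℝⁿ. -/
abbrev E (n : ℕ) := EuclideanSpace ℝ (Fin n)

/-- The Laplacian of `u : ℝⁿ → ℝ`: the sum of its second partial derivatives. -/
noncomputable def lap {n : ℕ} (u : E n → ℝ) (x : E n) : ℝ :=
  ∑ i : Fin n,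
    iteratedFDeriv ℝ 2 u x ![EuclideanSpace.single i 1, EuclideanSpace.single i 1]

open Filter Topology

/-- `p` has derivative `p₁` and second derivative `p₂` at `0`. -/
def HasJet (p : ℝ → ℝ) (p₁ p₂ : ℝ) : Prop :=
  ∃ p' : ℝ → ℝ, (∀ᶠ s in 𝓝 0, HasDerivAt p (p' s) s) ∧ p' 0 = p₁ ∧ HasDerivAt p' p₂ 0

namespace HasJet

variable {p q : ℝ → ℝ} {p₁ p₂ q₁ q₂ : ℝ}

theorem hasDerivAt (h : HasJet p p₁ p₂) : HasDerivAt p p₁ 0 := by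
  obtain ⟨p', h, rfl, -⟩ := h
  exact h.self_of_nhds

theorem add (hp : HasJet p p₁ p₂) (hq : HasJet q q₁ q₂) :
    HasJet (fun s => p s + q s) (p₁ + q₁) (p₂ + q₂) := by
  obtain ⟨p', h, rfl, h'⟩ := hp
  obtain ⟨q', k, rfl, k'⟩ := hq
  refine ⟨fun s => p' s + q' s, ?_, rfl, h'.add k'⟩
  filter_upwards [h, k] with s hs ks using hs.add ks

theorem const_mul (c : ℝ) (hp : HasJet p p₁ p₂) :
    HasJet (fun s => c * p s) (c * p₁) (c * p₂) := by
  obtain ⟨p', h, rfl, h'⟩ := hp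
  refine ⟨fun s => c * p' s, ?_, rfl, h'.const_mul c⟩
  filter_upwards [h] with s hs using hs.const_mul c

theorem sub (hp : HasJet p p₁ p₂) (hq : HasJet q q₁ q₂) :
    HasJet (fun s => p s - q s) (p₁ - q₁) (p₂ - q₂) := by
  simpa [sub_eq_add_neg] using hp.add (hq.const_mul (-1))

theorem const_add (c : ℝ) (hp : HasJet p p₁ p₂) : HasJet (fun s => c + p s) p₁ p₂ := by
  obtain ⟨p', h, rfl, h'⟩ := hp
  exact ⟨p', h.mono fun s hs => hs.const_add c, rfl, h'⟩

theorem comp {f f' : ℝ → ℝ} {f₂ : ℝ} (hf : ∀ᶠ y in 𝓝 (p 0), HasDerivAt f (f' y) y)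
    (hf' : HasDerivAt f' f₂ (p 0)) (hp : HasJet p p₁ p₂) :
    HasJet (fun s => f (p s)) (f' (p 0) * p₁) (f₂ * p₁ ^ 2 + f' (p 0) * p₂) := by
  have hd := hp.hasDerivAt
  obtain ⟨p', h, rfl, h'⟩ := hp
  refine ⟨fun s => f' (p s) * p' s, ?_, rfl, ?_⟩
  · filter_upwards [h, hd.continuousAt.eventually hf] with s hs ks
    exact ks.comp s hs
  · refine ((hf'.comp 0 hd).mul h').congr_deriv ?_
    simp only [Function.comp]
    ring

theorem exp (hp : HasJet p p₁ p₂) :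
    HasJet (fun s => Real.exp (p s)) (Real.exp (p 0) * p₁) (Real.exp (p 0) * (p₁ ^ 2 + p₂)) := by
  have := hp.comp (.of_forall fun y => Real.hasDerivAt_exp y) (Real.hasDerivAt_exp (p 0))
  rwa [← mul_add] at this

theorem log (hp : HasJet p p₁ p₂) (h0 : p 0 ≠ 0) :
    HasJet (fun s => Real.log (p s)) (p₁ / p 0) (p₂ / p 0 - (p₁ / p 0) ^ 2) := by
  have h1 : ∀ᶠ y in 𝓝 (p 0), HasDerivAt Real.log (y⁻¹) y := by
    filter_upwards [isOpen_ne.mem_nhds h0] with y hy using Real.hasDerivAt_log hy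
  convert hp.comp h1 (hasDerivAt_inv h0) using 1
  · field_simp
  · field_simp
    ring

theorem unique (hp : HasJet p p₁ p₂) (hq : HasJet p q₁ q₂) : p₁ = q₁ ∧ p₂ = q₂ := by
  refine ⟨hp.hasDerivAt.unique hq.hasDerivAt, ?_⟩
  obtain ⟨p', h, -, h'⟩ := hp
  obtain ⟨q', k, -, k'⟩ := hq
  refine h'.unique (k'.congr_of_eventuallyEq ?_)
  filter_upwards [h, k] with s hs ks using hs.unique ks

theorem nonpos_of_isLocalMax (hp : HasJet p p₁ p₂) (hm : IsLocalMax p 0) : p₂ ≤ 0 := by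
  by_contra! hpos
  have h0 : deriv p 0 = 0 := hm.deriv_eq_zero
  obtain ⟨p', h, -, h'⟩ := hp
  have he : deriv p =ᶠ[𝓝 0] p' := h.mono fun s hs => hs.deriv
  have h2 : deriv (deriv p) 0 = p₂ := he.deriv_eq.trans h'.deriv
  have hmin := isLocalMin_of_deriv_deriv_pos (h2 ▸ hpos) h0 h.self_of_nhds.continuousAt
  have hc : p =ᶠ[𝓝 0] fun _ => p 0 := by
    filter_upwards [hm, hmin] with s hs ks using le_antisymm hs ks
  have : deriv (deriv p) 0 = 0 := by
    have h3 : deriv p =ᶠ[𝓝 0] fun _ => 0 := by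
      simpa using hc.deriv
    simpa using h3.deriv_eq
  linarith

end HasJet

section Space

variable {F : Type*} [NormedAddCommGroup F] [InnerProductSpace ℝ F]

theorem ContDiffAt.hasJet {f : F → ℝ} {x : F} (hf : ContDiffAt ℝ 2 f x) (v : F) :
    HasJet (fun s : ℝ => f (x + s • v)) (fderiv ℝ f x v) (fderiv ℝ (fderiv ℝ f) x v v) := by
  have hline : ∀ s : ℝ, HasDerivAt (fun s : ℝ => x + s • v) v s := fun s => by
    simpa using ((hasDerivAt_id s).smul_const v).const_add x
  have hx : x + (0 : ℝ) • v = x := by simp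
  refine ⟨fun s => fderiv ℝ f (x + s • v) v, ?_, by simp, ?_⟩
  · have hc : ContinuousAt (fun s : ℝ => x + s • v) 0 := (hline 0).continuousAt
    have he : ∀ᶠ y in 𝓝 (x + (0 : ℝ) • v), ContDiffAt ℝ 2 f y := by
      rw [hx]; exact hf.eventually (by simp)
    filter_upwards [hc.eventually he] with s hs
    exact ((hs.differentiableAt (by simp)).hasFDerivAt).comp_hasDerivAt s (hline s)
  · have h1 : HasFDerivAt (fderiv ℝ f) (fderiv ℝ (fderiv ℝ f) x) (x + (0 : ℝ) • v) := by
      rw [hx]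
      exact ((hf.fderiv_right (m := 1) (by norm_num)).differentiableAt (by simp)).hasFDerivAt
    have h2 : HasDerivAt (fun s : ℝ => fderiv ℝ f (x + s • v)) (fderiv ℝ (fderiv ℝ f) x v) 0 :=
      h1.comp_hasDerivAt 0 (hline 0)
    simpa using h2.clm_apply (hasDerivAt_const 0 v)

theorem hasJet_norm_sq (x v : F) :
    HasJet (fun s : ℝ => ‖x + s • v‖ ^ 2) (2 * inner ℝ x v) (2 * ‖v‖ ^ 2) := by
  have he : ∀ s : ℝ, ‖x + s • v‖ ^ 2 = ‖x‖ ^ 2 + (2 * inner ℝ x v) * s + ‖v‖ ^ 2 * s ^ 2 := by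
    intro s
    rw [norm_add_sq_real, inner_smul_right, norm_smul, mul_pow, Real.norm_eq_abs, sq_abs]
    ring
  refine ⟨fun s => 2 * inner ℝ x v + ‖v‖ ^ 2 * (2 * s), ?_, by simp, ?_⟩
  · refine .of_forall fun s => ?_
    simp only [he]
    have := ((((hasDerivAt_id s).const_mul (2 * inner ℝ x v)).const_add (‖x‖ ^ 2)).add
      ((hasDerivAt_pow 2 s).const_mul (‖v‖ ^ 2)))
    refine this.congr_deriv ?_
    simp
  · have := (((hasDerivAt_id (0:ℝ)).const_mul 2).const_mul (‖v‖ ^ 2)).const_add (2 * inner ℝ x v)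
    refine this.congr_deriv ?_
    ring

end Space

section Bernstein

variable {F : Type*} [NormedAddCommGroup F] [InnerProductSpace ℝ F]

theorem abs_sub_sub_fderiv_le {w : F → ℝ} {s : Set F} (hs : Convex ℝ s) {L : ℝ}
    (hd : ∀ x ∈ s, DifferentiableAt ℝ w x)
    (hL : ∀ x ∈ s, ∀ y ∈ s, ‖fderiv ℝ w y - fderiv ℝ w x‖ ≤ L * ‖y - x‖) (hL0 : 0 ≤ L)
    {x y : F} (hx : x ∈ s) (hy : y ∈ s) :
    |w y - w x - fderiv ℝ w x (y - x)| ≤ L * ‖y - x‖ ^ 2 := by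
  have hseg : segment ℝ x y ⊆ s := hs.segment_subset hx hy
  have := (convex_segment x y).norm_image_sub_le_of_norm_hasFDerivWithin_le'
    (f := w) (f' := fderiv ℝ w) (φ := fderiv ℝ w x) (C := L * ‖y - x‖)
    (fun z hz => (hd z (hseg hz)).hasFDerivAt.hasFDerivWithinAt)
    (fun z hz => (hL x hx z (hseg hz)).trans
      (mul_le_mul_of_nonneg_left (by
        simpa using norm_sub_le_of_mem_segment hz) hL0))
    (left_mem_segment ℝ x y) (right_mem_segment ℝ x y)
  rw [Real.norm_eq_abs] at this
  linarith [this, sq ‖y - x‖, mul_assoc L ‖y - x‖ ‖y - x‖]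

variable [FiniteDimensional ℝ F]

/-- The discretised Bernstein functional attains interior maxima close to `z`. -/
theorem frequently_isLocalMax_difference {w ψ : F → ℝ} {z : F} (B : F →L[ℝ] F)
    (hw : ContDiffAt ℝ 2 w z) (hψ : ContDiffAt ℝ 2 ψ z)
    (hmax : IsLocalMax (fun x => ‖gradient w x‖ ^ 2 - ψ x) z) {δ : ℝ} (hδ : 0 < δ) :
    ∃ᶠ q : ℝ × F in 𝓝[>] 0 ×ˢ 𝓝 z, IsLocalMax (fun x =>
      2 / q.1 * (w (x + q.1 • (gradient w z + B (x - z))) - w x)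
        - (‖gradient w z + B (x - z)‖ ^ 2 + (ψ x + δ * ‖x - z‖ ^ 2))) q.2 := by
  set a : F → F := fun x => gradient w z + B (x - z) with ha
  have ha_cont : Continuous a := by fun_prop
  obtain ⟨L, s, hs, hL⟩ := (hw.fderiv_right (m := 1) (by norm_num)).exists_lipschitzOnWith
  have hev : ∀ᶠ x in 𝓝 z, x ∈ s ∧ ContDiffAt ℝ 2 w x ∧ ContDiffAt ℝ 2 ψ x ∧
      ‖gradient w x‖ ^ 2 - ψ x ≤ ‖gradient w z‖ ^ 2 - ψ z :=
    Filter.Eventually.and hs ((hw.eventually (by simp)).and ((hψ.eventually (by simp)).and hmax))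
  obtain ⟨r₀, hr₀, hball⟩ := Metric.eventually_nhds_iff_ball.1 hev
  rw [Filter.frequently_iff]
  intro U hU
  obtain ⟨U₁, hU₁, U₂, hU₂, hUU⟩ := Filter.mem_prod_iff.1 hU
  obtain ⟨r₁, hr₁, hball₁⟩ := Metric.mem_nhds_iff.1 hU₂
  obtain ⟨r, hr, hr0, hr1⟩ : ∃ r : ℝ, 0 < r ∧ 2 * r < r₀ ∧ r < r₁ :=
    ⟨min (r₀ / 3) (r₁ / 2), by positivity, by
      have := min_le_left (r₀ / 3) (r₁ / 2); linarith, by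
      have := min_le_right (r₀ / 3) (r₁ / 2); linarith⟩
  set A : ℝ := ‖gradient w z‖ + ‖B‖ * r + 1 with hA
  have hA0 : 0 < A := by positivity
  have haA : ∀ x ∈ closedBall z r, ‖a x‖ ≤ A := by
    intro x hx
    have h1 : ‖B (x - z)‖ ≤ ‖B‖ * r :=
      (B.le_opNorm _).trans (mul_le_mul_of_nonneg_left (mem_closedBall_iff_norm.1 hx)
        (norm_nonneg _))
    have := norm_add_le (gradient w z) (B (x - z))
    simp only [ha]
    linarith
  have ht : ∀ᶠ t : ℝ in 𝓝[>] 0, t ∈ U₁ ∧ 0 < t ∧ t * A < r ∧ 4 * L * A ^ 2 * t < δ * r ^ 2 := by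
    have h1 : ∀ᶠ t : ℝ in 𝓝 0, t * A < r :=
      (Continuous.tendsto' (by fun_prop) 0 0 (by simp)).eventually_lt_const hr
    have h2 : ∀ᶠ t : ℝ in 𝓝 0, 4 * L * A ^ 2 * t < δ * r ^ 2 :=
      (Continuous.tendsto' (by fun_prop) 0 0 (by simp)).eventually_lt_const (by positivity)
    exact Filter.Eventually.and hU₁ (Filter.Eventually.and self_mem_nhdsWithin
      ((h1.filter_mono nhdsWithin_le_nhds).and (h2.filter_mono nhdsWithin_le_nhds)))
  obtain ⟨t, htU, ht0, htA, htL⟩ := ht.exists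
  set K : F → ℝ := fun x => 2 / t * (w (x + t • a x) - w x)
    - (‖a x‖ ^ 2 + (ψ x + δ * ‖x - z‖ ^ 2)) with hK
  have hin : ∀ x ∈ closedBall z r, x ∈ ball z r₀ ∧ x + t • a x ∈ ball z r₀ := by
    intro x hx
    have h0 := mem_closedBall_iff_norm.1 hx
    refine ⟨mem_ball_iff_norm.2 (by linarith), mem_ball_iff_norm.2 ?_⟩
    have h1 : ‖t • a x‖ ≤ t * A := by
      rw [norm_smul, Real.norm_of_nonneg ht0.le]
      exact mul_le_mul_of_nonneg_left (haA x hx) ht0.le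
    have h2 : x + t • a x - z = (x - z) + t • a x := by abel
    rw [h2]
    linarith [norm_add_le (x - z) (t • a x)]
  have happrox : ∀ x ∈ closedBall z r,
      |2 / t * (w (x + t • a x) - w x) - 2 * fderiv ℝ w x (a x)| ≤ 2 * L * A ^ 2 * t := by
    intro x hx
    obtain ⟨h1, h2⟩ := hin x hx
    have h3 := abs_sub_sub_fderiv_le (convex_ball z r₀) (w := w) (L := L)
      (fun y hy => (hball y hy).2.1.differentiableAt (by simp))
      (fun y hy y' hy' => by
        simpa [dist_eq_norm] using hL.dist_le_mul _ (hball y' hy').1 _ (hball y hy).1)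
      L.2 h1 h2
    rw [add_sub_cancel_left, map_smul, smul_eq_mul, norm_smul, Real.norm_of_nonneg ht0.le] at h3
    have h4 : 2 / t * (w (x + t • a x) - w x) - 2 * fderiv ℝ w x (a x)
        = 2 / t * (w (x + t • a x) - w x - t * fderiv ℝ w x (a x)) := by
      field_simp
    rw [h4, abs_mul, abs_of_pos (by positivity : 0 < 2 / t)]
    calc 2 / t * |w (x + t • a x) - w x - t * fderiv ℝ w x (a x)|
        ≤ 2 / t * (L * (t * A) ^ 2) := by
          refine mul_le_mul_of_nonneg_left (h3.trans ?_) (by positivity)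
          have := haA x hx
          gcongr
      _ = 2 * L * A ^ 2 * t := by field_simp
  have hcont : ContinuousOn K (closedBall z r) := by
    intro x hx
    have h1 := (hball x (hin x hx).1).2.1.continuousAt
    have h2 : ContinuousAt (fun x => w (x + t • a x)) x :=
      ContinuousAt.comp (f := fun x => x + t • a x) (hball _ (hin x hx).2).2.1.continuousAt
        (by fun_prop)
    have h3 := (hball x (hin x hx).1).2.2.1.continuousAt
    refine ContinuousAt.continuousWithinAt ?_
    exact (continuousAt_const.mul (h2.sub h1)).sub
      ((ha_cont.norm.pow 2).continuousAt.add (h3.add (by fun_prop)))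
  obtain ⟨x, hx, hxmax⟩ := (isCompact_closedBall z r).exists_isMaxOn
    ⟨z, mem_closedBall_self hr.le⟩ hcont
  have hzz : a z = gradient w z := by simp [ha]
  have hgrad : ∀ x, fderiv ℝ w x (a x) = inner ℝ (gradient w x) (a x) := fun x => by
    simp [gradient]
  have hKz := hxmax (mem_closedBall_self hr.le)
  have hupper := abs_le.1 (happrox x hx)
  have hlower := abs_le.1 (happrox z (mem_closedBall_self hr.le))
  have hmaxx := (hball x (hin x hx).1).2.2.2
  have hxr : ‖x - z‖ < r := by
    by_contra! hcon
    have hsq : r ^ 2 ≤ ‖x - z‖ ^ 2 := by gcongr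
    have hsq' := mul_le_mul_of_nonneg_left hsq hδ.le
    have hexp := norm_sub_sq_real (gradient w x) (a x)
    have hnn := sq_nonneg ‖gradient w x - a x‖
    simp only [mem_ofPred_eq, hK, sub_self, norm_zero] at hKz
    rw [hgrad] at hupper hlower
    rw [hzz, real_inner_self_eq_norm_sq] at hlower
    rw [hzz] at hKz
    nlinarith
  refine ⟨(t, x), hUU ⟨htU, hball₁ (mem_ball_iff_norm.2 (by linarith))⟩, ?_⟩
  exact hxmax.isLocalMax (closedBall_mem_nhds_of_mem (mem_ball_iff_norm.2 hxr))

end Bernstein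

/-- Bernstein inequality at a local maximum of `‖∇w‖² - ψ`, for `w` of class `C²` only: the
Hessian term of the Bochner formula is tested against an arbitrary linear map `B`. -/
theorem bernstein_of_isLocalMax {F : Type*} [NormedAddCommGroup F] [InnerProductSpace ℝ F]
    [FiniteDimensional ℝ F] {ι : Type*} [Fintype ι] (e : ι → F) {w ψ g : F → ℝ} {z : F}
    {g' : F →L[ℝ] ℝ} (B : F →L[ℝ] F)
    (hw : ContDiffAt ℝ 2 w z) (hψ : ContDiffAt ℝ 2 ψ z) (hg : HasStrictFDerivAt g g' z)
    (hlap : ∀ᶠ x in 𝓝 z, ∑ i, fderiv ℝ (fderiv ℝ w) x (e i) (e i) = g x)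
    (hmax : IsLocalMax (fun x => ‖gradient w x‖ ^ 2 - ψ x) z) :
    2 * g' (gradient w z) + 2 * ∑ i, (fderiv ℝ (fderiv ℝ w) z (e i) (B (e i))
        + fderiv ℝ (fderiv ℝ w) z (B (e i)) (e i)) - 2 * ∑ i, ‖B (e i)‖ ^ 2
      ≤ ∑ i, fderiv ℝ (fderiv ℝ ψ) z (e i) (e i) := by
  suffices h : ∀ δ > 0, 2 * g' (gradient w z) + 2 * ∑ i, (fderiv ℝ (fderiv ℝ w) z (e i) (B (e i))
        + fderiv ℝ (fderiv ℝ w) z (B (e i)) (e i)) - (2 * ∑ i, ‖B (e i)‖ ^ 2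
      + ∑ i, fderiv ℝ (fderiv ℝ ψ) z (e i) (e i) + δ * (2 * ∑ i, ‖e i‖ ^ 2)) ≤ 0 by
    have hlim : Tendsto (fun δ : ℝ => 2 * g' (gradient w z)
        + 2 * ∑ i, (fderiv ℝ (fderiv ℝ w) z (e i) (B (e i))
        + fderiv ℝ (fderiv ℝ w) z (B (e i)) (e i)) - (2 * ∑ i, ‖B (e i)‖ ^ 2
        + ∑ i, fderiv ℝ (fderiv ℝ ψ) z (e i) (e i) + δ * (2 * ∑ i, ‖e i‖ ^ 2))) (𝓝[>] 0)
        (𝓝 (2 * g' (gradient w z) + 2 * ∑ i, (fderiv ℝ (fderiv ℝ w) z (e i) (B (e i))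
        + fderiv ℝ (fderiv ℝ w) z (B (e i)) (e i)) - (2 * ∑ i, ‖B (e i)‖ ^ 2
        + ∑ i, fderiv ℝ (fderiv ℝ ψ) z (e i) (e i) + 0 * (2 * ∑ i, ‖e i‖ ^ 2)))) :=
      (Continuous.tendsto (by fun_prop) 0).mono_left nhdsWithin_le_nhds
    have := le_of_tendsto hlim (by filter_upwards [self_mem_nhdsWithin] with δ hδ using h δ hδ)
    linarith
  intro δ hδ
  set a : F → F := fun x => gradient w z + B (x - z) with ha
  have ha_cont : Continuous a := by fun_prop
  have hza : a z = gradient w z := by simp [ha]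
  set y : ℝ × F → F := fun q => q.2 + q.1 • a q.2 with hy
  have hfst : Tendsto (fun q : ℝ × F => q.1) (𝓝[>] 0 ×ˢ 𝓝 z) (𝓝[>] 0) := tendsto_fst
  have hfst' : Tendsto (fun q : ℝ × F => q.1) (𝓝[>] 0 ×ˢ 𝓝 z) (𝓝 0) :=
    hfst.mono_right nhdsWithin_le_nhds
  have hsnd : Tendsto (fun q : ℝ × F => q.2) (𝓝[>] 0 ×ˢ 𝓝 z) (𝓝 z) := tendsto_snd
  have hat : Tendsto (fun q : ℝ × F => a q.2) (𝓝[>] 0 ×ˢ 𝓝 z) (𝓝 (gradient w z)) :=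
    (hza ▸ ha_cont.tendsto z).comp hsnd
  have hyt : Tendsto y (𝓝[>] 0 ×ˢ 𝓝 z) (𝓝 z) := by
    simpa using hsnd.add (hfst'.smul hat)
  have hD2 : ∀ {f : F → ℝ}, ContDiffAt ℝ 2 f z → ContinuousAt (fderiv ℝ (fderiv ℝ f)) z :=
    fun hf => ((hf.fderiv_right (m := 1) (by norm_num)).fderiv_right (m := 0)
      (by norm_num)).continuousAt
  have happ : ∀ {f : F → ℝ} {k : ℝ × F → F}, ContDiffAt ℝ 2 f z →
      Tendsto k (𝓝[>] 0 ×ˢ 𝓝 z) (𝓝 z) → ∀ v v' : F,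
      Tendsto (fun q => fderiv ℝ (fderiv ℝ f) (k q) v v') (𝓝[>] 0 ×ˢ 𝓝 z)
        (𝓝 (fderiv ℝ (fderiv ℝ f) z v v')) := by
    intro f k hf hk v v'
    have h1 : Tendsto (fun q => fderiv ℝ (fderiv ℝ f) (k q)) (𝓝[>] 0 ×ˢ 𝓝 z)
        (𝓝 (fderiv ℝ (fderiv ℝ f) z)) := (hD2 hf).tendsto.comp hk
    have h2 : Continuous fun A : F →L[ℝ] F →L[ℝ] ℝ => A v v' := by fun_prop
    exact (h2.tendsto _).comp h1
  have hquot : Tendsto (fun q : ℝ × F => q.1⁻¹ * (g (y q) - g q.2)) (𝓝[>] 0 ×ˢ 𝓝 z)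
      (𝓝 (g' (gradient w z))) := by
    have h1 := (hg.isLittleO.comp_tendsto (hyt.prodMk_nhds hsnd))
    have h2 : (fun q : ℝ × F => y q - q.2) =O[𝓝[>] 0 ×ˢ 𝓝 z] fun q => q.1 := by
      have h3 : (fun q : ℝ × F => a q.2) =O[𝓝[>] 0 ×ˢ 𝓝 z] fun _ => (1 : ℝ) := hat.isBigO_one ℝ
      have h4 := (Asymptotics.isBigO_refl (fun q : ℝ × F => q.1) (𝓝[>] 0 ×ˢ 𝓝 z)).smul h3
      simpa [hy] using h4
    have h5 := (h1.trans_isBigO h2).tendsto_div_nhds_zero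
    have h6 : Tendsto (fun q : ℝ × F => g' (a q.2)) (𝓝[>] 0 ×ˢ 𝓝 z) (𝓝 (g' (gradient w z))) :=
      (g'.continuous.tendsto _).comp hat
    have h7 := h5.add h6
    rw [zero_add] at h7
    refine h7.congr' ?_
    filter_upwards [hfst.eventually self_mem_nhdsWithin] with q hq
    have hq0 : q.1 ≠ 0 := ne_of_gt hq
    simp only [Function.comp, hy, add_sub_cancel_left, map_smul, smul_eq_mul]
    field_simp
    ring
  have hlim : Tendsto (fun q : ℝ × F => 2 * (q.1⁻¹ * (g (y q) - g q.2))
      + (2 * ∑ i, (fderiv ℝ (fderiv ℝ w) (y q) (e i) (B (e i))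
        + fderiv ℝ (fderiv ℝ w) (y q) (B (e i)) (e i))
      + 2 * q.1 * ∑ i, fderiv ℝ (fderiv ℝ w) (y q) (B (e i)) (B (e i)))
      - (2 * ∑ i, ‖B (e i)‖ ^ 2 + ∑ i, fderiv ℝ (fderiv ℝ ψ) q.2 (e i) (e i)
        + δ * (2 * ∑ i, ‖e i‖ ^ 2))) (𝓝[>] 0 ×ˢ 𝓝 z)
      (𝓝 (2 * g' (gradient w z) + (2 * ∑ i, (fderiv ℝ (fderiv ℝ w) z (e i) (B (e i))
        + fderiv ℝ (fderiv ℝ w) z (B (e i)) (e i))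
      + 2 * 0 * ∑ i, fderiv ℝ (fderiv ℝ w) z (B (e i)) (B (e i)))
      - (2 * ∑ i, ‖B (e i)‖ ^ 2 + ∑ i, fderiv ℝ (fderiv ℝ ψ) z (e i) (e i)
        + δ * (2 * ∑ i, ‖e i‖ ^ 2)))) := by
    refine ((hquot.const_mul 2).add (((tendsto_finsetSum _ fun i _ =>
      (happ hw hyt _ _).add (happ hw hyt _ _)).const_mul 2).add
      ((hfst'.const_mul 2).mul (tendsto_finsetSum _ fun i _ => happ hw hyt _ _)))).sub
      ((tendsto_const_nhds.add (tendsto_finsetSum _ fun i _ => happ hψ hsnd _ _)).add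
        tendsto_const_nhds)
  rw [mul_zero, zero_mul, add_zero] at hlim
  refine le_of_tendsto_of_frequently hlim ?_
  refine ((frequently_isLocalMax_difference B hw hψ hmax hδ).and_eventually
    ((hfst.eventually self_mem_nhdsWithin).and
      ((hyt.eventually ((hw.eventually (by simp)).and hlap)).and
        (hsnd.eventually ((hw.eventually (by simp)).and
          ((hψ.eventually (by simp)).and hlap)))))).mono ?_
  rintro ⟨t, x⟩ ⟨hloc, ht, ⟨hwy, hgy⟩, hwx, hψx, hgx⟩
  simp only [hy] at hwy hgy hwx hψx hgx ⊢
  have ht0 : (0 : ℝ) < t := ht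
  have key : ∀ i, 2 / t * (fderiv ℝ (fderiv ℝ w) (x + t • a x) (e i + t • B (e i))
      (e i + t • B (e i)) - fderiv ℝ (fderiv ℝ w) x (e i) (e i))
      - (2 * ‖B (e i)‖ ^ 2 + (fderiv ℝ (fderiv ℝ ψ) x (e i) (e i) + δ * (2 * ‖e i‖ ^ 2))) ≤ 0 := by
    intro i
    have h1 := (((hwy.hasJet (e i + t • B (e i))).sub (hwx.hasJet (e i))).const_mul (2 / t)).sub
      ((hasJet_norm_sq (a x) (B (e i))).add
        ((hψx.hasJet (e i)).add ((hasJet_norm_sq (x - z) (e i)).const_mul δ)))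
    refine h1.nonpos_of_isLocalMax ?_
    have hline : ContinuousAt (fun s : ℝ => x + s • e i) 0 := by fun_prop
    rw [show (t, x).2 = x + (0 : ℝ) • e i by simp] at hloc
    have hloc' := IsLocalMax.comp_continuous (g := fun s : ℝ => x + s • e i) (b := 0) hloc hline
    convert hloc' using 2 with s
    have e1 : a (x + s • e i) = a x + s • B (e i) := by
      simp only [ha, map_sub, map_add, map_smul]; abel
    have e2 : x + s • e i + t • (a x + s • B (e i))
        = x + t • a x + s • (e i + t • B (e i)) := by
      simp only [smul_add, smul_smul, mul_comm t s]; abel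
    have e3 : x + s • e i - z = x - z + s • e i := by abel
    have e4 : gradient w z + B (x - z + s • e i) = a x + s • B (e i) := by
      rw [← e3]; exact e1
    simp only [Function.comp, e3, e4, e2]
  have hsum := Finset.sum_nonpos fun i (_ : i ∈ Finset.univ) => key i
  simp only [map_add, map_smul, add_apply, smul_apply, smul_eq_mul, Finset.sum_sub_distrib,
    Finset.sum_add_distrib, ← Finset.mul_sum, hgx, hgy] at hsum
  simp only [Finset.sum_add_distrib]
  refine le_of_eq_of_le ?_ hsum
  field_simp
  ring

section Euclidean

variable {n : ℕ}

theorem lap_eq_sum_fderiv (f : E n → ℝ) (x : E n) :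
    lap f x = ∑ i, fderiv ℝ (fderiv ℝ f) x (EuclideanSpace.single i 1)
      (EuclideanSpace.single i 1) := by
  simp [lap, iteratedFDeriv_two_apply]

theorem sum_sq_inner_single (v : E n) :
    ∑ i, inner ℝ v (EuclideanSpace.single i 1) ^ 2 = ‖v‖ ^ 2 := by
  simp [EuclideanSpace.norm_sq_eq, EuclideanSpace.inner_single_right]

theorem sum_inner_smul_single (v : E n) :
    ∑ i, inner ℝ v (EuclideanSpace.single i 1) • (EuclideanSpace.single i 1 : E n) = v := by
  have := (EuclideanSpace.basisFun (Fin n) ℝ).sum_repr' v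
  simpa [real_inner_comm] using this

theorem ContDiffAt.gradient_one {w : E n → ℝ} {z : E n} (hw : ContDiffAt ℝ 2 w z) :
    ContDiffAt ℝ 1 (gradient w) z :=
  (InnerProductSpace.toDual ℝ (E n)).symm.contDiff.contDiffAt.comp z
    (hw.fderiv_right (m := 1) (by norm_num))

theorem hasFDerivAt_norm_gradient_sq {w : E n → ℝ} {z : E n} (hw : ContDiffAt ℝ 2 w z) :
    ∃ L : E n →L[ℝ] ℝ, HasFDerivAt (fun x => ‖gradient w x‖ ^ 2) L z ∧
      ∀ v, L v = 2 * fderiv ℝ (fderiv ℝ w) z v (gradient w z) := by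
  have h1 : HasFDerivAt (fderiv ℝ w) (fderiv ℝ (fderiv ℝ w) z) z :=
    ((hw.fderiv_right (m := 1) (by norm_num)).differentiableAt (by simp)).hasFDerivAt
  have h2 : HasFDerivAt (gradient w) _ z :=
    ((InnerProductSpace.toDual ℝ (E n)).symm.toContinuousLinearEquiv.hasFDerivAt).comp z h1
  refine ⟨_, h2.norm_sq, fun v => ?_⟩
  simp only [ContinuousLinearMap.comp_apply, smul_apply, innerSL_apply_apply, nsmul_eq_mul]
  rw [real_inner_comm]
  congr 1
  exact InnerProductSpace.toDual_symm_apply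

/-- The Bernstein inequality for `Δw = -(‖∇w‖² + exp (a w))`, tested against a combination of the
identity and `∇w ⊗ ∇w`. -/
theorem bernstein_log {w ψ : E n → ℝ} {z : E n} {a N : ℝ} (hN : (n : ℝ) ≤ N) (hN0 : 0 < N)
    (hw : ContDiffAt ℝ 2 w z) (hψ : ContDiffAt ℝ 2 ψ z)
    (heq : ∀ᶠ x in 𝓝 z, lap w x = -(‖gradient w x‖ ^ 2 + Real.exp (a * w x)))
    (hmax : IsLocalMax (fun x => ‖gradient w x‖ ^ 2 - ψ x) z) (τ : ℝ) {φ h X : ℝ}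
    (hφ : φ = ‖gradient w z‖ ^ 2) (hh : h = Real.exp (a * w z))
    (hX : X = fderiv ℝ ψ z (gradient w z)) :
    2 * (φ + h) ^ 2 / N + 4 * τ * φ * (φ + h) / N + 2 * τ * X - 2 * τ ^ 2 * φ ^ 2 * (N - 1) / N
      - 2 * X - 2 * a * h * φ ≤ lap ψ z := by
  set G := gradient w z with hG
  obtain ⟨L, hL, hL'⟩ := hasFDerivAt_norm_gradient_sq hw
  have hψd := (hψ.differentiableAt (by simp)).hasFDerivAt
  have hwd := (hw.differentiableAt (by simp)).hasFDerivAt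
  have hLψ : L = fderiv ℝ ψ z := by
    have := hmax.hasFDerivAt_eq_zero (hL.sub hψd)
    exact sub_eq_zero.1 this
  have hXw : fderiv ℝ (fderiv ℝ w) z G G = X / 2 := by
    have := hL' G
    rw [hLψ] at this
    linarith
  set g : E n → ℝ := fun x => -(‖gradient w x‖ ^ 2 + Real.exp (a * w x)) with hg
  have hgd : HasFDerivAt g (-(L + Real.exp (a * w z) • a • fderiv ℝ w z)) z :=
    (hL.add ((hwd.const_mul a).exp)).neg
  have hgc : ContDiffAt ℝ 1 g z :=
    ((hw.gradient_one.norm_sq ℝ).add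
      ((contDiffAt_const.mul (hw.of_le (by norm_num))).exp)).neg
  have hgs := hgc.hasStrictFDerivAt' hgd (by simp)
  have hlap : ∀ᶠ x in 𝓝 z, ∑ i : Fin n, fderiv ℝ (fderiv ℝ w) x (EuclideanSpace.single i 1)
      (EuclideanSpace.single i 1) = g x := by
    filter_upwards [heq] with x hx
    rw [← lap_eq_sum_fderiv, hx]
  set lam : ℝ := -(φ + h + τ * φ) / N with hlam
  set B : E n →L[ℝ] E n := lam • ContinuousLinearMap.id ℝ (E n)
    + τ • (innerSL ℝ G).smulRight G with hB
  have hBv : ∀ v, B v = lam • v + (τ * inner ℝ G v) • G := fun v => by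
    simp [hB, smul_smul]
  have key := bernstein_of_isLocalMax (fun i : Fin n => EuclideanSpace.single i (1 : ℝ)) B hw hψ
    hgs hlap hmax
  rw [← lap_eq_sum_fderiv] at key
  refine le_trans ?_ key
  set D := fderiv ℝ (fderiv ℝ w) z with hD
  have hS : ∑ i : Fin n, D (EuclideanSpace.single i 1) (EuclideanSpace.single i 1) = -(φ + h) := by
    rw [hlap.self_of_nhds, hg, hφ, hh]
  have hGG : fderiv ℝ w z G = φ := by
    rw [← inner_gradient_left, hφ, real_inner_self_eq_norm_sq]
  have hsum1 : ∑ i : Fin n, inner ℝ G (EuclideanSpace.single i 1) *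
      D (EuclideanSpace.single i 1) G = X / 2 := by
    rw [← hXw]
    conv_rhs => enter [1]; rw [← sum_inner_smul_single G]
    simp
  have hsum2 : ∑ i : Fin n, inner ℝ G (EuclideanSpace.single i 1) *
      D G (EuclideanSpace.single i 1) = X / 2 := by
    rw [← hXw]
    conv_rhs => enter [2]; rw [← sum_inner_smul_single G]
    simp
  have hcross : ∑ i : Fin n, (D (EuclideanSpace.single i 1) (B (EuclideanSpace.single i 1))
      + D (B (EuclideanSpace.single i 1)) (EuclideanSpace.single i 1))
      = 2 * lam * (-(φ + h)) + τ * X := by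
    rw [← hS]
    simp only [hBv, map_add, map_smul, add_apply, smul_apply, smul_eq_mul,
      Finset.sum_add_distrib, mul_assoc, ← Finset.mul_sum, hsum1, hsum2]
    ring
  have hnorm : ∑ i : Fin n, ‖B (EuclideanSpace.single i 1)‖ ^ 2
      = n * lam ^ 2 + 2 * lam * τ * φ + τ ^ 2 * φ ^ 2 := by
    have : ∀ i : Fin n, ‖B (EuclideanSpace.single i 1)‖ ^ 2 = lam ^ 2
        + (2 * lam * τ + τ ^ 2 * φ) * inner ℝ G (EuclideanSpace.single i 1) ^ 2 := by
      intro i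
      rw [hBv, norm_add_sq_real, norm_smul, norm_smul, mul_pow, mul_pow, inner_smul_left,
        inner_smul_right, real_inner_comm, hφ, Real.norm_eq_abs, Real.norm_eq_abs, sq_abs, sq_abs]
      simp
      ring
    simp only [this, Finset.sum_add_distrib, ← Finset.mul_sum, sum_sq_inner_single, ← hφ]
    simp
    ring
  rw [hcross, hnorm]
  have hgG : (-(L + Real.exp (a * w z) • a • fderiv ℝ w z)) G = -(X + a * h * φ) := by
    simp only [neg_apply, add_apply, smul_apply, smul_eq_mul, hGG, hLψ, ← hX, ← hh]
    ring
  rw [hgG]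
  have hn : (n : ℝ) * lam ^ 2 ≤ N * lam ^ 2 := by gcongr
  have hfin : 2 * (φ + h) ^ 2 / N + 4 * τ * φ * (φ + h) / N + 2 * τ * X
      - 2 * τ ^ 2 * φ ^ 2 * (N - 1) / N - 2 * X - 2 * a * h * φ
      = 2 * (-(X + a * h * φ)) + 2 * (2 * lam * (-(φ + h)) + τ * X)
        - 2 * (N * lam ^ 2 + 2 * lam * τ * φ + τ ^ 2 * φ ^ 2) := by
    rw [hlam]
    field_simp
    ring
  linarith

end Euclidean

section Coercivity

/-- The quadratic form in `(φ, h)` produced by the Bernstein inequality for the auxiliary function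
`exp (-ℓ w) * (φ + d * h)`, where `b = ℓ'` and `b₁ = ℓ''`. -/
noncomputable def bernsteinForm (N a d b b₁ τ φ h : ℝ) : ℝ :=
  2 * (φ + h) ^ 2 / N + 4 * τ * φ * (φ + h) / N - 2 * τ ^ 2 * φ ^ 2 * (N - 1) / N
    + (2 * τ - 2) * ((φ + d * h) * (b * φ) - d * a * h * φ) - 2 * a * h * φ
    - (φ + d * h) * (b ^ 2 * φ + b₁ * φ - b * (φ + h)) + d * h * (a ^ 2 * φ - a * (φ + h))

theorem bernsteinForm_eq {N : ℝ} (hN : 2 ≤ N) (a d b b₁ φ h : ℝ) :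
    bernsteinForm N a d b b₁ ((N * b + 2) / (2 * (N - 1))) φ h
      = ((2 - (N - 2) * b) * (b + 2) / (2 * (N - 1)) - b₁) * φ ^ 2
        + (4 / N + (N * b + 2) / (N - 1) * (d * (b - a) + 2 / N) - d * (b - a) * (1 + a + b)
          - 2 * a + b - d * b₁) * (φ * h)
        + (2 / N + d * (b - a)) * h ^ 2 := by
  have h1 : N - 1 ≠ 0 := by linarith
  have h2 : N ≠ 0 := by linarith
  unfold bernsteinForm
  field_simp
  ring

theorem exists_bernsteinForm_ge_near {N a : ℝ} (hN : 2 ≤ N) (ha : 0 < a) (haN : a * (N - 2) < 4) :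
    ∃ d > 0, ∃ κ > 0, ∃ c > 0, ∀ b b₁ : ℝ, |b - a / 2| < κ → |b₁| < κ → ∀ φ h : ℝ, 0 ≤ φ → 0 ≤ h →
      c * (φ + d * h) ^ 2 ≤ bernsteinForm N a d b b₁ ((N * b + 2) / (2 * (N - 1))) φ h := by
  have h1 : 0 < N - 1 := by linarith
  have h2 : 0 < N := by linarith
  set G : ℝ := 2 - (N - 2) * (a / 2) with hG
  have hG0 : 0 < G := by rw [hG]; linarith
  obtain ⟨δ, hδ, hδN, hδG⟩ : ∃ δ : ℝ, 0 < δ ∧ δ ≤ 1 / N ∧ δ * (1 + 3 * (a / 2)) ≤ G / N := by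
    refine ⟨min (1 / N) (G / N / (1 + 3 * (a / 2))), by positivity, min_le_left _ _, ?_⟩
    rw [← le_div_iff₀ (by positivity)]
    exact min_le_right _ _
  set d : ℝ := (2 / N - δ) / (a / 2) with hd
  have hd0 : 0 < d := by
    have : 1 / N < 2 / N := by gcongr; norm_num
    rw [hd]
    exact div_pos (by linarith) (by positivity)
  have hda : d * (a / 2 - a) = -(2 / N) + δ := by
    rw [hd]; field_simp; ring
  set f : ℝ × ℝ → ℝ := fun q => (2 - (N - 2) * q.1) * (q.1 + 2) / (2 * (N - 1)) - q.2 with hf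
  set k : ℝ × ℝ → ℝ := fun q => 4 / N + (N * q.1 + 2) / (N - 1) * (d * (q.1 - a) + 2 / N)
    - d * (q.1 - a) * (1 + a + q.1) - 2 * a + q.1 - d * q.2 with hk
  set l : ℝ × ℝ → ℝ := fun q => 2 / N + d * (q.1 - a) with hl
  have hf0 : 0 < f (a / 2, 0) := by
    simp only [hf, sub_zero, ← hG]
    positivity
  have hk0 : 0 < k (a / 2, 0) := by
    simp only [hk, hda]
    have e : 4 / N + (N * (a / 2) + 2) / (N - 1) * (-(2 / N) + δ + 2 / N)
        - (-(2 / N) + δ) * (1 + a + a / 2) - 2 * a + a / 2 - d * 0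
        = 3 * (G / N) - δ * (1 + 3 * (a / 2)) + (N * (a / 2) + 2) / (N - 1) * δ := by
      rw [hG]; field_simp; ring
    rw [e]
    have : 0 < (N * (a / 2) + 2) / (N - 1) * δ := by positivity
    have : 0 < G / N := by positivity
    linarith
  have hl0 : 0 < l (a / 2, 0) := by
    simp only [hl, hda]
    linarith
  obtain ⟨c₀, hc₀, hc₁, hc₂, hc₃⟩ : ∃ c₀ : ℝ, 0 < c₀ ∧ c₀ < f (a / 2, 0) ∧ c₀ < k (a / 2, 0) ∧
      c₀ < l (a / 2, 0) := by
    obtain ⟨c₀, h, h'⟩ := exists_between (lt_min hf0 (lt_min hk0 hl0))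
    simp only [lt_min_iff] at h'
    exact ⟨c₀, h, h'.1, h'.2.1, h'.2.2⟩
  have hev : ∀ᶠ q in 𝓝 ((a / 2, 0) : ℝ × ℝ), c₀ < f q ∧ c₀ < k q ∧ c₀ < l q := by
    have cf : Continuous f := by fun_prop
    have ck : Continuous k := by fun_prop
    have cl : Continuous l := by fun_prop
    exact (cf.continuousAt.eventually_const_lt hc₁).and
      ((ck.continuousAt.eventually_const_lt hc₂).and (cl.continuousAt.eventually_const_lt hc₃))
  obtain ⟨κ, hκ, hball⟩ := Metric.eventually_nhds_iff.1 hev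
  refine ⟨d, hd0, κ, hκ, c₀ / (1 + d) ^ 2, by positivity, ?_⟩
  intro b b₁ hb hb₁ φ h hφ hh
  obtain ⟨hf', hk', hl'⟩ := @hball (b, b₁) (by
    simpa [Prod.dist_eq, Real.dist_eq] using ⟨hb, hb₁⟩)
  rw [bernsteinForm_eq hN]
  have e1 : c₀ * φ ^ 2 ≤ f (b, b₁) * φ ^ 2 := by gcongr
  have e2 : c₀ * (φ * h) ≤ k (b, b₁) * (φ * h) := by gcongr
  have e3 : c₀ * h ^ 2 ≤ l (b, b₁) * h ^ 2 := by gcongr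
  simp only [hf, hk, hl] at e1 e2 e3
  have e4 : c₀ / (1 + d) ^ 2 * (φ + d * h) ^ 2 ≤ c₀ * φ ^ 2 + c₀ * (φ * h) + c₀ * h ^ 2 := by
    have e5 : (φ + d * h) ^ 2 ≤ (1 + d) ^ 2 * (φ ^ 2 + φ * h + h ^ 2) := by
      have := mul_nonneg hφ hh
      nlinarith [mul_nonneg (sq_nonneg d) (sq_nonneg φ), mul_nonneg hd0.le (sq_nonneg φ),
        mul_nonneg hd0.le (sq_nonneg h), mul_nonneg (sq_nonneg d) this, sq_nonneg h]
    calc c₀ / (1 + d) ^ 2 * (φ + d * h) ^ 2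
        ≤ c₀ / (1 + d) ^ 2 * ((1 + d) ^ 2 * (φ ^ 2 + φ * h + h ^ 2)) := by gcongr
      _ = _ := by field_simp
  linarith

theorem quadratic_form_ge {c d f k l M H φ h : ℝ} (hd : 0 < d) (hM : 0 ≤ M) (hc : 0 ≤ c)
    (hφ : 0 ≤ φ) (hh : 0 ≤ h) (hhH : h ≤ H) (hf : c ≤ f) (hk : -M ≤ k) (hl : -M ≤ l) :
    c * (φ + d * h) ^ 2 - (M * H * (1 + 1 / d) + 3 * c * d * H) * (φ + d * h)
      ≤ f * φ ^ 2 + k * (φ * h) + l * h ^ 2 := by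
  have hH : 0 ≤ H := hh.trans hhH
  have e1 := mul_le_mul_of_nonneg_right hf (sq_nonneg φ)
  have e2 := mul_le_mul_of_nonneg_right hk (mul_nonneg hφ hh)
  have e3 := mul_le_mul_of_nonneg_right hl (sq_nonneg h)
  have e4 : φ * h ≤ H * φ := by nlinarith
  have e5 : h ^ 2 ≤ H * h := by nlinarith
  have e6 : M * (φ * h) ≤ M * (H * φ) := by gcongr
  have e7 : M * h ^ 2 ≤ M * (H * h) := by gcongr
  have e8 : c * d * (φ * h) ≤ c * d * (H * φ) := by gcongr
  have e9 : c * d ^ 2 * h ^ 2 ≤ c * d ^ 2 * (H * h) := by gcongr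
  have e10 : 0 ≤ M * H * (φ * d⁻¹) + M * H * (d * h) := by positivity
  have e11 : 0 ≤ c * d * (H * φ) := by positivity
  have e12 : 0 ≤ c * d ^ 2 * (H * h) := by positivity
  have hdd : d * d⁻¹ = 1 := mul_inv_cancel₀ hd.ne'
  have eK : (M * H * (1 + 1 / d) + 3 * c * d * H) * (φ + d * h) = M * (H * φ) + M * (H * h)
      + (M * H * (φ * d⁻¹) + M * H * (d * h))
      + 3 * (c * d * (H * φ)) + 3 * (c * d ^ 2 * (H * h)) := by
    linear_combination (M * H * h) * hdd
  have eP : c * (φ + d * h) ^ 2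
      = c * φ ^ 2 + 2 * (c * d * (φ * h)) + c * d ^ 2 * h ^ 2 := by ring
  rw [eP, eK]
  linarith

theorem exists_bernsteinForm_ge {N a : ℝ} (hN : 2 ≤ N) (ha : 0 < a) (haN : a * (N - 2) < 4) :
    ∃ d > 0, ∃ σ > 0, ∃ c > 0, ∃ K T : ℝ, ∀ r θ : ℝ, θ = Real.exp (σ * r) →
      ∃ τ, |τ| ≤ T ∧ ∀ φ, 0 ≤ φ → c * (φ + d * Real.exp r) ^ 2 - K * (φ + d * Real.exp r)
        ≤ bernsteinForm N a d (a / 2 * (θ / (1 + θ))) (a / 2 * (σ * a * θ / (1 + θ) ^ 2)) τ φ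
          (Real.exp r) := by
  have h1 : 0 < N - 1 := by linarith
  have h2 : 0 < N := by linarith
  obtain ⟨d, hd, κ, hκ, c, hc, hnear⟩ := exists_bernsteinForm_ge_near hN ha haN
  set G : ℝ := 2 - (N - 2) * (a / 2) with hG
  have hG0 : 0 < G := by rw [hG]; linarith
  set c₁ : ℝ := G / (2 * (N - 1)) with hc₁
  have hc₁0 : 0 < c₁ := by positivity
  obtain ⟨m, hm, hmκ, hmc, hm1⟩ : ∃ m : ℝ, 0 < m ∧ m < κ ∧ m < c₁ ∧ m < 1 := by
    obtain ⟨m, h, h'⟩ := exists_between (lt_min hκ (lt_min hc₁0 one_pos))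
    simp only [lt_min_iff] at h'
    exact ⟨m, h, h'.1, h'.2.1, h'.2.2⟩
  set σ : ℝ := m / (a / 2 * a) with hσ
  have hσ0 : 0 < σ := by positivity
  obtain ⟨M, hM⟩ : ∃ M : ℝ, ∀ b ∈ Icc (0 : ℝ) (a / 2), ∀ b₁ ∈ Icc (0 : ℝ) 1,
      -M ≤ 4 / N + (N * b + 2) / (N - 1) * (d * (b - a) + 2 / N) - d * (b - a) * (1 + a + b)
          - 2 * a + b - d * b₁ ∧ -M ≤ 2 / N + d * (b - a) := by
    have hcpt : IsCompact (Icc (0 : ℝ) (a / 2) ×ˢ Icc (0 : ℝ) 1) := isCompact_Icc.prod isCompact_Icc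
    obtain ⟨M₁, hM₁⟩ := hcpt.exists_bound_of_continuousOn
      (f := fun q : ℝ × ℝ => 4 / N + (N * q.1 + 2) / (N - 1) * (d * (q.1 - a) + 2 / N)
        - d * (q.1 - a) * (1 + a + q.1) - 2 * a + q.1 - d * q.2)
      (Continuous.continuousOn (by fun_prop))
    obtain ⟨M₂, hM₂⟩ := hcpt.exists_bound_of_continuousOn
      (f := fun q : ℝ × ℝ => 2 / N + d * (q.1 - a)) (Continuous.continuousOn (by fun_prop))
    refine ⟨max M₁ M₂, fun b hb b₁ hb₁ => ⟨?_, ?_⟩⟩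
    · have := (abs_le.1 (hM₁ (b, b₁) ⟨hb, hb₁⟩)).1
      exact (neg_le_neg (le_max_left _ _)).trans this
    · have := (abs_le.1 (hM₂ (b, b₁) ⟨hb, hb₁⟩)).1
      exact (neg_le_neg (le_max_right _ _)).trans this
  have hM' : ∀ b ∈ Icc (0 : ℝ) (a / 2), ∀ b₁ ∈ Icc (0 : ℝ) 1,
      -|M| ≤ 4 / N + (N * b + 2) / (N - 1) * (d * (b - a) + 2 / N) - d * (b - a) * (1 + a + b)
          - 2 * a + b - d * b₁ ∧ -|M| ≤ 2 / N + d * (b - a) := fun b hb b₁ hb₁ =>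
    ⟨(neg_le_neg (le_abs_self M)).trans (hM b hb b₁ hb₁).1,
      (neg_le_neg (le_abs_self M)).trans (hM b hb b₁ hb₁).2⟩
  set M' := |M| with hM'def
  have hM0 : 0 ≤ M' := abs_nonneg M
  set r₀ : ℝ := a / 2 / (κ * σ) with hr₀
  set H : ℝ := Real.exp r₀ with hH
  have hH0 : 0 < H := Real.exp_pos _
  set c' : ℝ := min c c₁ / 2 with hc'
  have hc'0 : 0 < c' := by positivity
  have hc'c : c' ≤ c := by
    have := min_le_left c c₁
    rw [hc']; linarith
  have hc'c₁ : c' ≤ c₁ := by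
    have := min_le_right c c₁
    rw [hc']; linarith
  set K : ℝ := M' * H * (1 + 1 / d) + 3 * c' * d * H with hK
  have hK0 : 0 ≤ K := by positivity
  refine ⟨d, hd, σ, hσ0, c', hc'0, K, (N * (a / 2) + 2) / (2 * (N - 1)), ?_⟩
  intro r θ hθ
  have hθ0 : 0 < θ := hθ ▸ Real.exp_pos _
  set b : ℝ := a / 2 * (θ / (1 + θ)) with hb
  set b₁ : ℝ := a / 2 * (σ * a * θ / (1 + θ) ^ 2) with hb₁
  have hb0 : 0 ≤ b := by positivity
  have hba : b ≤ a / 2 := by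
    have : θ / (1 + θ) ≤ 1 := by rw [div_le_one (by positivity)]; linarith
    calc b ≤ a / 2 * 1 := by rw [hb]; gcongr
      _ = a / 2 := mul_one _
  have hb₁0 : 0 ≤ b₁ := by positivity
  have hb₁m : b₁ ≤ m := by
    have e : b₁ = m * (θ / (1 + θ) ^ 2) := by
      rw [hb₁, hσ]; field_simp
    have : θ / (1 + θ) ^ 2 ≤ 1 := by
      rw [div_le_one (by positivity)]; nlinarith
    rw [e]
    nlinarith
  refine ⟨(N * b + 2) / (2 * (N - 1)), ?_, ?_⟩
  · rw [abs_of_nonneg (by positivity)]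
    gcongr
  intro φ hφ
  set h := Real.exp r with hh
  have hh0 : 0 < h := Real.exp_pos _
  set P := φ + d * h with hP
  have hP0 : 0 ≤ P := by positivity
  rcases lt_or_ge r₀ r with hr | hr
  · have hbκ : |b - a / 2| < κ := by
      have e : b - a / 2 = -(a / 2 / (1 + θ)) := by
        rw [hb]; field_simp; ring
      rw [e, abs_neg, abs_of_nonneg (by positivity), div_lt_iff₀ (by positivity)]
      have h3 : a / 2 < κ * (σ * r) := by
        rw [hr₀, div_lt_iff₀ (by positivity)] at hr
        linarith
      have h4 : σ * r + 1 ≤ θ := hθ ▸ Real.add_one_le_exp _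
      nlinarith
    have := hnear b b₁ hbκ (by rw [abs_of_nonneg hb₁0]; linarith) φ h hφ hh0.le
    have h5 : c' * P ^ 2 ≤ c * P ^ 2 := by gcongr
    have h6 : 0 ≤ K * P := by positivity
    linarith
  · have hhH : h ≤ H := Real.exp_le_exp.2 hr
    obtain ⟨hk, hl⟩ := hM' b ⟨hb0, hba⟩ b₁ ⟨hb₁0, by linarith⟩
    have hf : c₁ ≤ (2 - (N - 2) * b) * (b + 2) / (2 * (N - 1)) - b₁ := by
      have h3 : 2 * c₁ ≤ (2 - (N - 2) * b) * (b + 2) / (2 * (N - 1)) := by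
        have e : 2 * c₁ = G * 2 / (2 * (N - 1)) := by rw [hc₁]; ring
        have h4 : G ≤ 2 - (N - 2) * b := by
          rw [hG]
          have : (N - 2) * b ≤ (N - 2) * (a / 2) :=
            mul_le_mul_of_nonneg_left hba (by linarith)
          linarith
        rw [e]
        gcongr <;> linarith
      linarith
    rw [bernsteinForm_eq hN]
    exact quadratic_form_ge hd hM0 hc'0.le hφ hh0.le hhH (hc'c₁.trans hf) hk hl

end Coercivity

section Gradient

variable {n : ℕ}

theorem jet_barrier {w ζ : E n → ℝ} {z : E n} {ℓ b : ℝ → ℝ} {b₁ : ℝ} (m a d : ℝ)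
    (hw : ContDiffAt ℝ 2 w z) (hζ : ContDiffAt ℝ 2 ζ z) (hℓ : ∀ s, HasDerivAt ℓ (b s) s)
    (hb : HasDerivAt b b₁ (w z)) (v : E n) :
    HasJet (fun s : ℝ => Real.exp (m + (ℓ (w (z + s • v)) + ζ (z + s • v)))
        - d * Real.exp (a * w (z + s • v)))
      (Real.exp (m + (ℓ (w z) + ζ z)) * (b (w z) * fderiv ℝ w z v + fderiv ℝ ζ z v)
        - d * (Real.exp (a * w z) * (a * fderiv ℝ w z v)))
      (Real.exp (m + (ℓ (w z) + ζ z)) * ((b (w z) * fderiv ℝ w z v + fderiv ℝ ζ z v) ^ 2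
          + (b₁ * fderiv ℝ w z v ^ 2 + b (w z) * fderiv ℝ (fderiv ℝ w) z v v
            + fderiv ℝ (fderiv ℝ ζ) z v v))
        - d * (Real.exp (a * w z) * ((a * fderiv ℝ w z v) ^ 2
          + a * fderiv ℝ (fderiv ℝ w) z v v))) := by
  have h0 : z + (0 : ℝ) • v = z := by simp
  have h1 := (((hw.hasJet v).comp (f := ℓ) (f' := b) (f₂ := b₁) (.of_forall hℓ)
    (by rwa [h0])).add (hζ.hasJet v)).const_add m
  have h2 := h1.exp.sub (((hw.hasJet v).const_mul a).exp.const_mul d)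
  simpa only [h0] using h2

theorem barrier_fderiv_lap {w ζ : E n → ℝ} {z : E n} {ℓ b : ℝ → ℝ} {b₁ : ℝ} (m a d : ℝ)
    (hw : ContDiffAt ℝ 2 w z) (hζ : ContDiffAt ℝ 2 ζ z) (hℓ₂ : ContDiff ℝ 2 ℓ)
    (hℓ : ∀ s, HasDerivAt ℓ (b s) s) (hb : HasDerivAt b b₁ (w z)) {ψ : E n → ℝ}
    (hψ : ψ = fun x => Real.exp (m + (ℓ (w x) + ζ x)) - d * Real.exp (a * w x)) :
    ContDiffAt ℝ 2 ψ z ∧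
    (∀ v, fderiv ℝ ψ z v = Real.exp (m + (ℓ (w z) + ζ z))
        * (b (w z) * fderiv ℝ w z v + fderiv ℝ ζ z v)
        - d * (Real.exp (a * w z) * (a * fderiv ℝ w z v))) ∧
    lap ψ z = Real.exp (m + (ℓ (w z) + ζ z)) * (b (w z) ^ 2 * ‖gradient w z‖ ^ 2
        + 2 * b (w z) * fderiv ℝ ζ z (gradient w z) + ‖gradient ζ z‖ ^ 2
        + b₁ * ‖gradient w z‖ ^ 2 + b (w z) * lap w z + lap ζ z)
      - d * Real.exp (a * w z) * (a ^ 2 * ‖gradient w z‖ ^ 2 + a * lap w z) := by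
  have hψc : ContDiffAt ℝ 2 ψ z := by
    rw [hψ]
    exact (contDiffAt_const.add ((hℓ₂.contDiffAt.comp z hw).add hζ)).exp.sub
      (contDiffAt_const.mul (contDiffAt_const.mul hw).exp)
  have hjet : ∀ v, _ := fun v => (hψc.hasJet v).unique
    (by rw [hψ]; exact jet_barrier m a d hw hζ hℓ hb v)
  refine ⟨hψc, fun v => (hjet v).1, ?_⟩
  have e1 : ∀ f : E n → ℝ, ∑ i : Fin n, fderiv ℝ f z (EuclideanSpace.single i 1) ^ 2
      = ‖gradient f z‖ ^ 2 := fun f => by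
    rw [← sum_sq_inner_single]
    exact Finset.sum_congr rfl fun i _ => by rw [inner_gradient_left]
  have e2 : ∑ i : Fin n, fderiv ℝ w z (EuclideanSpace.single i 1)
      * fderiv ℝ ζ z (EuclideanSpace.single i 1) = fderiv ℝ ζ z (gradient w z) := by
    conv_rhs => rw [← sum_inner_smul_single (gradient w z)]
    simp only [map_sum, map_smul, smul_eq_mul, inner_gradient_left]
  rw [lap_eq_sum_fderiv ψ, Finset.sum_congr rfl fun i _ => (hjet (EuclideanSpace.single i 1)).2]
  rw [lap_eq_sum_fderiv w, lap_eq_sum_fderiv ζ, ← e1, ← e1, ← e2]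
  simp only [Finset.mul_sum, ← Finset.sum_add_distrib, ← Finset.sum_sub_distrib]
  refine Finset.sum_congr rfl fun i _ => ?_
  ring

/-- The logarithmic cutoff `-2 log (1 - ‖x - x₀‖² / ρ²)`. -/
theorem log_cutoff_bounds (x₀ : E n) {ρ : ℝ} (hρ : 0 < ρ) {z : E n} (hz : z ∈ ball x₀ ρ)
    {ζ : E n → ℝ} (hζ : ζ = fun x => -2 * Real.log (1 + -(1 / ρ ^ 2) * ‖x - x₀‖ ^ 2)) :
    0 < 1 + -(1 / ρ ^ 2) * ‖z - x₀‖ ^ 2 ∧ ContDiffAt ℝ 2 ζ z ∧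
    ‖gradient ζ z‖ ^ 2 * (1 + -(1 / ρ ^ 2) * ‖z - x₀‖ ^ 2) ^ 2 ≤ 16 / ρ ^ 2 ∧
    lap ζ z * (1 + -(1 / ρ ^ 2) * ‖z - x₀‖ ^ 2) ^ 2 ≤ (4 * n + 8) / ρ ^ 2 := by
  have hnorm : ‖z - x₀‖ < ρ := mem_ball_iff_norm.1 hz
  have hsq : ‖z - x₀‖ ^ 2 < ρ ^ 2 := by gcongr
  set q : ℝ := 1 + -(1 / ρ ^ 2) * ‖z - x₀‖ ^ 2 with hq
  have hq0 : 0 < q := by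
    have : 1 / ρ ^ 2 * ‖z - x₀‖ ^ 2 < 1 := by
      rw [one_div, inv_mul_lt_iff₀ (by positivity)]; linarith
    linarith
  have hq1 : q ≤ 1 := by
    have : 0 ≤ 1 / ρ ^ 2 * ‖z - x₀‖ ^ 2 := by positivity
    linarith
  have hζc : ContDiffAt ℝ 2 ζ z := by
    rw [hζ]
    refine contDiffAt_const.mul (ContDiffAt.log ?_ hq0.ne')
    exact contDiffAt_const.add (contDiffAt_const.mul
      (((contDiffAt_id.sub contDiffAt_const)).norm_sq ℝ))
  have hjet : ∀ v, fderiv ℝ ζ z v = 4 / (ρ ^ 2 * q) * inner ℝ (z - x₀) v ∧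
      fderiv ℝ (fderiv ℝ ζ) z v v
        = 4 / (ρ ^ 2 * q) * ‖v‖ ^ 2 + 8 / (ρ ^ 2 * q) ^ 2 * inner ℝ (z - x₀) v ^ 2 := by
    intro v
    have h0 : z - x₀ + (0 : ℝ) • v = z - x₀ := by simp
    have h1 := (((((hasJet_norm_sq (z - x₀) v).const_mul (-(1 / ρ ^ 2))).const_add 1).log
      (by rw [h0]; exact hq0.ne')).const_mul (-2))
    have h2 := (hζc.hasJet v).unique (by
      rw [hζ]
      simpa only [add_sub_right_comm] using h1)
    rw [h0, ← hq] at h2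
    refine ⟨h2.1.trans ?_, h2.2.trans ?_⟩
    · field_simp
      ring
    · field_simp
      ring
  have hgrad : ‖gradient ζ z‖ ^ 2 = (4 / (ρ ^ 2 * q)) ^ 2 * ‖z - x₀‖ ^ 2 := by
    rw [← sum_sq_inner_single, ← sum_sq_inner_single, Finset.mul_sum]
    refine Finset.sum_congr rfl fun i _ => ?_
    rw [inner_gradient_left, (hjet _).1]
    ring
  have hlap : lap ζ z = 4 / (ρ ^ 2 * q) * n + 8 / (ρ ^ 2 * q) ^ 2 * ‖z - x₀‖ ^ 2 := by
    rw [lap_eq_sum_fderiv, Finset.sum_congr rfl fun i _ => (hjet _).2, Finset.sum_add_distrib,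
      ← Finset.mul_sum, ← Finset.mul_sum, sum_sq_inner_single]
    simp
  refine ⟨hq0, hζc, ?_, ?_⟩
  · have e : ‖gradient ζ z‖ ^ 2 * q ^ 2 = 16 / ρ ^ 2 * (‖z - x₀‖ ^ 2 / ρ ^ 2) := by
      rw [hgrad]; field_simp; ring
    have : ‖z - x₀‖ ^ 2 / ρ ^ 2 ≤ 1 := by rw [div_le_one (by positivity)]; exact hsq.le
    rw [e]
    exact mul_le_of_le_one_right (by positivity) this
  · have e : lap ζ z * q ^ 2 = 4 * n / ρ ^ 2 * q + 8 / ρ ^ 2 * (‖z - x₀‖ ^ 2 / ρ ^ 2) := by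
      rw [hlap]; field_simp
    have h3 : ‖z - x₀‖ ^ 2 / ρ ^ 2 ≤ 1 := by rw [div_le_one (by positivity)]; exact hsq.le
    have h4 : 4 * n / ρ ^ 2 * q ≤ 4 * n / ρ ^ 2 := mul_le_of_le_one_right (by positivity) hq1
    have h5 : 8 / ρ ^ 2 * (‖z - x₀‖ ^ 2 / ρ ^ 2) ≤ 8 / ρ ^ 2 :=
      mul_le_of_le_one_right (by positivity) h3
    rw [e, add_div]
    linarith

/-- Bernstein estimate for the auxiliary function `exp (-ℓ w) * (‖∇w‖² + d * exp (a w))`. -/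
theorem auxiliary_function_le {N a d c K T ρ : ℝ} (hN : (n : ℝ) ≤ N) (hN0 : 0 < N) (hd : 0 ≤ d)
    (hc : 0 < c) (hK : 0 ≤ K) (hρ : 0 < ρ) {x₀ : E n} {w : E n → ℝ}
    (hw : ∀ x ∈ closedBall x₀ ρ, ContDiffAt ℝ 2 w x)
    (heq : ∀ x ∈ ball x₀ ρ, lap w x = -(‖gradient w x‖ ^ 2 + Real.exp (a * w x)))
    {ℓ b b₁ : ℝ → ℝ} (hℓ₂ : ContDiff ℝ 2 ℓ) (hℓ : ∀ s, HasDerivAt ℓ (b s) s)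
    (hb : ∀ s, HasDerivAt b (b₁ s) s) (hℓ0 : ∀ s, 0 ≤ ℓ s) (hbT : ∀ s, |b s| ≤ T)
    (hform : ∀ s, ∃ τ, |τ| ≤ T ∧ ∀ φ, 0 ≤ φ →
      c * (φ + d * Real.exp (a * s)) ^ 2 - K * (φ + d * Real.exp (a * s))
        ≤ bernsteinForm N a d (b s) (b₁ s) τ φ (Real.exp (a * s)))
    {x : E n} (hx : x ∈ closedBall x₀ ρ) :
    (1 + -(1 / ρ ^ 2) * ‖x - x₀‖ ^ 2) ^ 2 *
        (Real.exp (-ℓ (w x)) * (‖gradient w x‖ ^ 2 + d * Real.exp (a * w x)))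
      ≤ 2 / c * (K + (((2 + 4 * T) ^ 2 / (2 * c) + 1) * (16 / ρ ^ 2) + (4 * n + 8) / ρ ^ 2)) := by
  set Q : E n → ℝ := fun x => (1 + -(1 / ρ ^ 2) * ‖x - x₀‖ ^ 2) ^ 2 *
    (Real.exp (-ℓ (w x)) * (‖gradient w x‖ ^ 2 + d * Real.exp (a * w x))) with hQ
  have hQc : ContinuousOn Q (closedBall x₀ ρ) := by
    intro y hy
    have h1 := (hw y hy).continuousAt
    have h2 := (hw y hy).gradient_one.continuousAt
    have h3 : ContinuousAt (fun y => ℓ (w y)) y :=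
      hℓ₂.continuous.continuousAt.comp h1
    refine ContinuousAt.continuousWithinAt ?_
    have h4 : ContinuousAt (fun x => (1 + -(1 / ρ ^ 2) * ‖x - x₀‖ ^ 2) ^ 2) y := by fun_prop
    exact h4.mul ((Real.continuous_exp.continuousAt.comp h3.neg).mul ((h2.norm.pow 2).add
      (continuousAt_const.mul (Real.continuous_exp.continuousAt.comp (continuousAt_const.mul h1)))))
  obtain ⟨z, hz, hzmax⟩ := (isCompact_closedBall x₀ ρ).exists_isMaxOn
    ⟨x₀, mem_closedBall_self hρ.le⟩ hQc
  refine (hzmax hx).trans ?_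
  change Q z ≤ _
  rcases le_or_gt (Q z) 0 with hM | hM
  · exact hM.trans (by positivity)
  have hzb : z ∈ ball x₀ ρ := by
    rw [mem_ball_iff_norm]
    refine lt_of_le_of_ne (mem_closedBall_iff_norm.1 hz) fun h => hM.ne' ?_
    simp only [hQ]
    rw [h]
    field_simp
    simp
  set ζ : E n → ℝ := fun x => -2 * Real.log (1 + -(1 / ρ ^ 2) * ‖x - x₀‖ ^ 2) with hζ
  obtain ⟨hq0, hζc, hξ, hΔζ⟩ := log_cutoff_bounds x₀ hρ hzb hζ
  set ψ : E n → ℝ := fun x => Real.exp (Real.log (Q z) + (ℓ (w x) + ζ x))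
    - d * Real.exp (a * w x) with hψ
  obtain ⟨hψc, hψ1, hψ2⟩ := barrier_fderiv_lap (Real.log (Q z)) a d (hw z hz) hζc hℓ₂ hℓ
    (hb (w z)) hψ
  have hψQ : ∀ y ∈ ball x₀ ρ, ‖gradient w y‖ ^ 2 - ψ y
      = (Q y - Q z) * (Real.exp (ℓ (w y)) / (1 + -(1 / ρ ^ 2) * ‖y - x₀‖ ^ 2) ^ 2) := by
    intro y hy
    obtain ⟨hq, -⟩ := log_cutoff_bounds x₀ hρ hy hζ
    have e1 : Real.exp (ζ y) = ((1 + -(1 / ρ ^ 2) * ‖y - x₀‖ ^ 2) ^ 2)⁻¹ := by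
      have : ζ y = -Real.log ((1 + -(1 / ρ ^ 2) * ‖y - x₀‖ ^ 2) ^ 2) := by
        rw [Real.log_pow, hζ]; push_cast; ring
      rw [this, Real.exp_neg, Real.exp_log (by positivity)]
    simp only [hψ]
    rw [Real.exp_add, Real.exp_add, Real.exp_log hM, e1, sub_mul]
    have e2 : Q y * (Real.exp (ℓ (w y)) / (1 + -(1 / ρ ^ 2) * ‖y - x₀‖ ^ 2) ^ 2)
        = ‖gradient w y‖ ^ 2 + d * Real.exp (a * w y) := by
      simp only [hQ]
      rw [Real.exp_neg]
      generalize 1 + -(1 / ρ ^ 2) * ‖y - x₀‖ ^ 2 = q at hq ⊢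
      field_simp
    rw [e2]
    ring
  have hball : ball x₀ ρ ∈ 𝓝 z := isOpen_ball.mem_nhds hzb
  have hmax : IsLocalMax (fun x => ‖gradient w x‖ ^ 2 - ψ x) z := by
    filter_upwards [hball] with y hy
    rw [hψQ y hy, hψQ z hzb, sub_self, zero_mul]
    exact mul_nonpos_of_nonpos_of_nonneg (sub_nonpos.2 (hzmax (ball_subset_closedBall hy)))
      (by positivity)
  obtain ⟨τ, hτ, hτform⟩ := hform (w z)
  set φ := ‖gradient w z‖ ^ 2 with hφ
  set h := Real.exp (a * w z) with hh
  have hφ0 : 0 ≤ φ := by positivity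
  have hh0 : 0 < h := Real.exp_pos _
  have key := bernstein_log hN hN0 (hw z hz) hψc
    (by filter_upwards [hball] with y hy using heq y hy) hmax τ hφ hh rfl
  set P := φ + d * h with hP
  have hPexp : Real.exp (Real.log (Q z) + (ℓ (w z) + ζ z)) = P := by
    have := hψQ z hzb
    rw [sub_self, zero_mul] at this
    simp only [hψ] at this
    linarith
  have hP0 : 0 < P := hPexp ▸ Real.exp_pos _
  have hDw : fderiv ℝ w z (gradient w z) = φ := by
    rw [← inner_gradient_left, hφ, real_inner_self_eq_norm_sq]
  set ξ := fderiv ℝ ζ z (gradient w z) with hξdef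
  have hform' := hτform φ hφ0
  rw [hψ2, hψ1, heq z hzb, hPexp, hDw, ← hξdef] at key
  set q := 1 + -(1 / ρ ^ 2) * ‖z - x₀‖ ^ 2 with hq
  have hmain : c * P - K ≤ (2 - 2 * τ + 2 * b (w z)) * ξ + ‖gradient ζ z‖ ^ 2 + lap ζ z := by
    refine le_of_mul_le_mul_left ?_ hP0
    unfold bernsteinForm at hform'
    rw [← hP] at hform'
    linarith
  have hξle : (2 - 2 * τ + 2 * b (w z)) * ξ
      ≤ c / 2 * P + (2 + 4 * T) ^ 2 / (2 * c) * ‖gradient ζ z‖ ^ 2 := by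
    have h1 : |ξ| ≤ ‖gradient ζ z‖ * ‖gradient w z‖ := by
      rw [hξdef, ← inner_gradient_left]
      exact abs_real_inner_le_norm _ _
    have h2 : |2 - 2 * τ + 2 * b (w z)| ≤ 2 + 4 * T := by
      have h3 := abs_le.1 hτ
      have h4 := abs_le.1 (hbT (w z))
      rw [abs_le]
      constructor <;> linarith
    have h5 : (2 - 2 * τ + 2 * b (w z)) * ξ
        ≤ (2 + 4 * T) * (‖gradient ζ z‖ * ‖gradient w z‖) := by
      refine (le_abs_self _).trans ?_
      rw [abs_mul]
      exact mul_le_mul h2 h1 (abs_nonneg _) ((abs_nonneg _).trans h2)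
    have h6 : (2 + 4 * T) * (‖gradient ζ z‖ * ‖gradient w z‖)
        ≤ c / 2 * φ + (2 + 4 * T) ^ 2 / (2 * c) * ‖gradient ζ z‖ ^ 2 := by
      rw [hφ]
      have e : c / 2 * ‖gradient w z‖ ^ 2 + (2 + 4 * T) ^ 2 / (2 * c) * ‖gradient ζ z‖ ^ 2
          - (2 + 4 * T) * (‖gradient ζ z‖ * ‖gradient w z‖)
          = (c * ‖gradient w z‖ - (2 + 4 * T) * ‖gradient ζ z‖) ^ 2 / (2 * c) := by
        field_simp
        ring
      have : 0 ≤ (c * ‖gradient w z‖ - (2 + 4 * T) * ‖gradient ζ z‖) ^ 2 / (2 * c) := by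
        positivity
      linarith
    have h7 : c / 2 * φ ≤ c / 2 * P := by
      gcongr
      rw [hP]
      have : 0 ≤ d * h := by positivity
      linarith
    linarith
  have hq1 : q ≤ 1 := by
    have : 0 ≤ 1 / ρ ^ 2 * ‖z - x₀‖ ^ 2 := by positivity
    linarith
  have hPle : c / 2 * P ≤ K + ((2 + 4 * T) ^ 2 / (2 * c) + 1) * ‖gradient ζ z‖ ^ 2 + lap ζ z := by
    linarith
  have hqP : c / 2 * (q ^ 2 * P) ≤ K + (((2 + 4 * T) ^ 2 / (2 * c) + 1) * (16 / ρ ^ 2)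
      + (4 * n + 8) / ρ ^ 2) := by
    have h1 := mul_le_mul_of_nonneg_right hPle (sq_nonneg q)
    have h2 : K * q ^ 2 ≤ K := mul_le_of_le_one_right hK (pow_le_one₀ hq0.le hq1)
    have h3 : ((2 + 4 * T) ^ 2 / (2 * c) + 1) * (‖gradient ζ z‖ ^ 2 * q ^ 2)
        ≤ ((2 + 4 * T) ^ 2 / (2 * c) + 1) * (16 / ρ ^ 2) := by gcongr
    linarith
  have hQP : Q z ≤ q ^ 2 * P := by
    have h1 : Real.exp (-ℓ (w z)) ≤ 1 := Real.exp_le_one_iff.2 (neg_nonpos.2 (hℓ0 _))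
    simp only [hQ]
    gcongr
    exact mul_le_of_le_one_left hP0.le h1
  have e : q ^ 2 * P = 2 / c * (c / 2 * (q ^ 2 * P)) := by field_simp
  refine hQP.trans ?_
  rw [e]
  gcongr

end Gradient

section Harnack

variable {n : ℕ}

theorem bernsteinForm_smul (N a d b b₁ τ k φ h : ℝ) :
    bernsteinForm N a d b b₁ τ (k * φ) (k * h) = k ^ 2 * bernsteinForm N a d b b₁ τ φ h := by
  unfold bernsteinForm
  ring

theorem le_of_exp_neg_mul_le {σ d A r Φ : ℝ} (hσ : 0 < σ) (hd : 0 < d) (hA : 0 ≤ A) (hΦ : 0 ≤ Φ)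
    (h : Real.exp (-(1 / (2 * σ) * Real.log (1 + Real.exp (σ * r)))) * (Φ + d * Real.exp r) ≤ A) :
    Φ ≤ A * Real.exp (Real.log 2 / (2 * σ))
      * (1 + A * Real.exp (Real.log 2 / (2 * σ)) / d) := by
  set B := Real.exp (Real.log 2 / (2 * σ)) with hB
  have hB0 : 0 < B := Real.exp_pos _
  rw [Real.exp_neg, inv_mul_le_iff₀ (Real.exp_pos _)] at h
  rcases le_total r 0 with hr | hr
  · have h1 : Real.exp (1 / (2 * σ) * Real.log (1 + Real.exp (σ * r))) ≤ B := by
      rw [hB, div_eq_mul_one_div (Real.log 2), mul_comm (Real.log 2)]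
      have : Real.exp (σ * r) ≤ 1 :=
        Real.exp_le_one_iff.2 (mul_nonpos_of_nonneg_of_nonpos hσ.le hr)
      gcongr
      linarith
    have h2 : 0 ≤ d * Real.exp r := by positivity
    have h3 : 0 ≤ A * B * (A * B / d) := by positivity
    have h4 := mul_le_mul_of_nonneg_right h1 hA
    linarith
  · have h1 : Real.exp (1 / (2 * σ) * Real.log (1 + Real.exp (σ * r))) ≤ B * Real.exp (r / 2) := by
      have e : B * Real.exp (r / 2)
          = Real.exp (1 / (2 * σ) * Real.log (2 * Real.exp (σ * r))) := by
        rw [hB, ← Real.exp_add, Real.log_mul two_ne_zero (Real.exp_pos _).ne', Real.log_exp]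
        congr 1
        field_simp
      have : 1 ≤ Real.exp (σ * r) := Real.one_le_exp (by positivity)
      rw [e]
      gcongr
      linarith
    have h2 := mul_le_mul_of_nonneg_right h1 hA
    set y := Real.exp (r / 2) with hy
    have hy0 : 0 < y := Real.exp_pos _
    have e2 : Real.exp r = y * y := by
      rw [hy, ← Real.exp_add, add_halves]
    rw [e2] at h
    have h3 : y ≤ A * B / d := by
      rw [le_div_iff₀ hd]
      refine le_of_mul_le_mul_right ?_ hy0
      linarith
    have h4 : 0 ≤ d * (y * y) := by positivity
    have h5 : A * B * y ≤ A * B * (A * B / d) := by gcongr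
    have h6 : 0 ≤ A * B := by positivity
    linarith

theorem quarter_le_cutoff {x₀ x : E n} {R : ℝ} (hR : 0 < R) (hx : x ∈ ball x₀ R) :
    1 / 4 ≤ (1 + -(1 / (3 / 2 * R) ^ 2) * ‖x - x₀‖ ^ 2) ^ 2 := by
  have h1 : ‖x - x₀‖ < R := mem_ball_iff_norm.1 hx
  have h2 : 1 / (3 / 2 * R) ^ 2 * ‖x - x₀‖ ^ 2 ≤ 1 / (3 / 2 * R) ^ 2 * R ^ 2 := by gcongr
  have h3 : 1 / (3 / 2 * R) ^ 2 * R ^ 2 = 4 / 9 := by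
    field_simp
    norm_num
  nlinarith

/-- Gradient estimate for `w = log u` when the exponent is at most one. -/
theorem norm_gradient_sq_le_of_nonpos (n : ℕ) {N a : ℝ} (hN : (n : ℝ) ≤ N) (hN0 : 2 ≤ N)
    (ha : a ≤ 0) :
    ∃ C : ℝ, 0 < C ∧ ∀ (x₀ : E n) (R : ℝ), 0 < R → ∀ w : E n → ℝ,
      (∀ x ∈ ball x₀ (2 * R), ContDiffAt ℝ 2 w x) →
      (∀ x ∈ ball x₀ (2 * R), lap w x = -(‖gradient w x‖ ^ 2 + Real.exp (a * w x))) →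
      ∀ x ∈ ball x₀ R, ‖gradient w x‖ ^ 2 ≤ C / R ^ 2 := by
  have h0 : 0 < N := by linarith
  refine ⟨4 * (2 / (2 / N) * (((2 + 4 * 0) ^ 2 / (2 * (2 / N)) + 1) * 16 + (4 * n + 8))),
    by positivity, fun x₀ R hR w hw heq x hx => ?_⟩
  have hρ : 0 < 3 / 2 * R := by positivity
  have hsub : closedBall x₀ (3 / 2 * R) ⊆ ball x₀ (2 * R) := closedBall_subset_ball (by linarith)
  have hform : ∀ s : ℝ, ∃ τ : ℝ, |τ| ≤ 0 ∧ ∀ φ, 0 ≤ φ →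
      2 / N * (φ + 0 * Real.exp (a * s)) ^ 2 - 0 * (φ + 0 * Real.exp (a * s))
        ≤ bernsteinForm N a 0 0 0 τ φ (Real.exp (a * s)) := by
    refine fun s => ⟨0, by simp, fun φ hφ => ?_⟩
    have hh := Real.exp_pos (a * s)
    generalize Real.exp (a * s) = h at hh
    have h1 : 2 / N * φ ^ 2 ≤ 2 / N * (φ + h) ^ 2 := by gcongr; linarith
    have h2 : 0 ≤ -a * (h * φ) := mul_nonneg (by linarith) (by positivity)
    have e : bernsteinForm N a 0 0 0 0 φ h = 2 / N * (φ + h) ^ 2 + 2 * (-a * (h * φ)) := by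
      unfold bernsteinForm
      ring
    rw [e, zero_mul, zero_mul, add_zero, sub_zero]
    linarith
  have key := auxiliary_function_le hN h0 le_rfl (by positivity : 0 < 2 / N) le_rfl hρ
    (fun y hy => hw y (hsub hy)) (fun y hy => heq y (hsub (ball_subset_closedBall hy)))
    (ℓ := fun _ => 0) (b := fun _ => 0) (b₁ := fun _ => 0) contDiff_const
    (fun s => hasDerivAt_const s 0) (fun s => hasDerivAt_const s 0) (fun _ => le_rfl)
    (fun _ => by simp) hform (ball_subset_closedBall (ball_subset_ball (by linarith) hx))
  have hcut := quarter_le_cutoff hR hx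
  have h3 := mul_le_mul_of_nonneg_right hcut (sq_nonneg ‖gradient w x‖)
  simp only [neg_zero, Real.exp_zero, zero_mul, add_zero, one_mul, zero_add] at key
  have h4 := mul_le_mul_of_nonneg_left (h3.trans key) (by positivity : 0 ≤ 4 * R ^ 2)
  rw [le_div_iff₀ (by positivity)]
  have e : 4 * R ^ 2 * (1 / 4 * ‖gradient w x‖ ^ 2) = ‖gradient w x‖ ^ 2 * R ^ 2 := by ring
  rw [e] at h4
  set D := 4 * (2 / (2 / N) * (((2 + 4 * 0) ^ 2 / (2 * (2 / N)) + 1) * 16 + (4 * n + 8))) with hD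
  have hD0 : 0 ≤ D := by positivity
  have e' : 4 * R ^ 2 * (2 / (2 / N) * (((2 + 4 * 0) ^ 2 / (2 * (2 / N)) + 1)
      * (16 / (3 / 2 * R) ^ 2) + (4 * n + 8) / (3 / 2 * R) ^ 2)) = 4 / 9 * D := by
    rw [hD]
    field_simp
    ring
  linarith

/-- Gradient estimate for `w = log u` when the exponent is larger than one. -/
theorem norm_gradient_sq_le_of_pos (n : ℕ) {N a : ℝ} (hN : (n : ℝ) ≤ N) (hN0 : 2 ≤ N)
    (ha : 0 < a) (haN : a * (N - 2) < 4) :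
    ∃ C : ℝ, 0 < C ∧ ∀ (x₀ : E n) (R : ℝ), 0 < R → ∀ w : E n → ℝ,
      (∀ x ∈ ball x₀ (2 * R), ContDiffAt ℝ 2 w x) →
      (∀ x ∈ ball x₀ (2 * R), lap w x = -(‖gradient w x‖ ^ 2 + Real.exp (a * w x))) →
      ∀ x ∈ ball x₀ R, ‖gradient w x‖ ^ 2 ≤ C / R ^ 2 := by
  have h0 : 0 < N := by linarith
  obtain ⟨d, hd, σ, hσ, c, hc, K, T, hform⟩ := exists_bernsteinForm_ge hN0 ha haN
  set T' := max T (a / 2) with hT'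
  set A := 4 * (2 / c * (|K| + (((2 + 4 * T') ^ 2 / (2 * c) + 1) * 16 + (4 * n + 8)))) with hA
  have hA0 : 0 < A := by positivity
  set B := Real.exp (Real.log 2 / (2 * σ)) with hB
  have hB0 : 0 < B := Real.exp_pos _
  refine ⟨A * B * (1 + A * B / d), by positivity, fun x₀ R hR w hw heq x hx => ?_⟩
  set ρ := 3 / 2 * R with hρdef
  have hρ : 0 < ρ := by positivity
  have hρ2 : Real.exp (2 * Real.log ρ) = ρ ^ 2 := by
    rw [two_mul, Real.exp_add, Real.exp_log hρ, sq]
  have hsub : closedBall x₀ ρ ⊆ ball x₀ (2 * R) := closedBall_subset_ball (by linarith)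
  set θ : ℝ → ℝ := fun s => Real.exp (σ * (a * s + 2 * Real.log ρ)) with hθ
  have hθ0 : ∀ s, 0 < θ s := fun s => Real.exp_pos _
  have hθd : ∀ s, HasDerivAt θ (σ * a * θ s) s := by
    intro s
    have := ((((hasDerivAt_id s).const_mul a).add_const (2 * Real.log ρ)).const_mul σ).exp
    refine this.congr_deriv ?_
    simp only [hθ, id]
    ring
  have hform' : ∀ s : ℝ, ∃ τ : ℝ, |τ| ≤ T' ∧ ∀ φ, 0 ≤ φ →
      c * (φ + d * Real.exp (a * s)) ^ 2 - |K| / ρ ^ 2 * (φ + d * Real.exp (a * s))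
        ≤ bernsteinForm N a d (a / 2 * (θ s / (1 + θ s)))
          (a / 2 * (σ * a * θ s / (1 + θ s) ^ 2)) τ φ (Real.exp (a * s)) := by
    intro s
    obtain ⟨τ, hτ, hτφ⟩ := hform (a * s + 2 * Real.log ρ) (θ s) rfl
    refine ⟨τ, hτ.trans (le_max_left _ _), fun φ hφ => ?_⟩
    have h1 := hτφ (ρ ^ 2 * φ) (by positivity)
    rw [Real.exp_add, hρ2, mul_comm (Real.exp (a * s)), bernsteinForm_smul] at h1
    have hh := Real.exp_pos (a * s)
    set h := Real.exp (a * s) with hhdef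
    have hP : 0 ≤ φ + d * h := by positivity
    refine le_of_mul_le_mul_left ?_ (by positivity : 0 < (ρ ^ 2) ^ 2)
    have h2 : K * (ρ ^ 2 * (φ + d * h)) ≤ |K| * (ρ ^ 2 * (φ + d * h)) := by
      gcongr
      exact le_abs_self K
    have e : (ρ ^ 2) ^ 2 * (c * (φ + d * h) ^ 2 - |K| / ρ ^ 2 * (φ + d * h))
        = c * (ρ ^ 2 * (φ + d * h)) ^ 2 - |K| * (ρ ^ 2 * (φ + d * h)) := by
      field_simp
    rw [e]
    have e2 : ρ ^ 2 * φ + d * (ρ ^ 2 * h) = ρ ^ 2 * (φ + d * h) := by ring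
    rw [e2] at h1
    linarith
  have key := auxiliary_function_le hN h0 hd.le hc (by positivity : 0 ≤ |K| / ρ ^ 2) hρ
    (fun y hy => hw y (hsub hy)) (fun y hy => heq y (hsub (ball_subset_closedBall hy)))
    (ℓ := fun s => 1 / (2 * σ) * Real.log (1 + θ s))
    (b := fun s => a / 2 * (θ s / (1 + θ s)))
    (b₁ := fun s => a / 2 * (σ * a * θ s / (1 + θ s) ^ 2))
    (contDiff_const.mul (ContDiff.log (by simp only [hθ]; fun_prop)
      fun s => by have := hθ0 s; positivity))
    (fun s => by
      have := hθ0 s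
      refine ((((hθd s).const_add 1).log (by positivity)).const_mul (1 / (2 * σ))).congr_deriv ?_
      field_simp)
    (fun s => by
      have := hθ0 s
      refine (((hθd s).div ((hθd s).const_add 1) (by positivity)).const_mul (a / 2)).congr_deriv ?_
      field_simp
      ring)
    (fun s => by
      have := hθ0 s
      exact mul_nonneg (by positivity) (Real.log_nonneg (by linarith)))
    (fun s => by
      have := hθ0 s
      rw [abs_of_nonneg (by positivity)]
      refine le_trans ?_ (le_max_right T (a / 2))
      refine mul_le_of_le_one_right (by positivity) ?_
      rw [div_le_one (by positivity)]
      linarith)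
    hform' (ball_subset_closedBall (ball_subset_ball (by linarith) hx))
  have hcut := quarter_le_cutoff hR hx
  rw [← hρdef] at hcut
  have hφ0 : 0 ≤ ‖gradient w x‖ ^ 2 := by positivity
  set φ := ‖gradient w x‖ ^ 2 with hφ
  set L := Real.exp (-(1 / (2 * σ) * Real.log (1 + θ (w x)))) with hL
  have hL0 : 0 < L := Real.exp_pos _
  have h3 := mul_le_mul_of_nonneg_right hcut
    (by positivity : 0 ≤ L * (φ + d * Real.exp (a * w x)))
  have h4 : L * (ρ ^ 2 * φ + d * Real.exp (a * w x + 2 * Real.log ρ)) ≤ A := by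
    rw [Real.exp_add, hρ2]
    have e : A = 4 * ρ ^ 2 * (2 / c * (|K| / ρ ^ 2 + (((2 + 4 * T') ^ 2 / (2 * c) + 1)
        * (16 / ρ ^ 2) + (4 * n + 8) / ρ ^ 2))) := by
      rw [hA]; field_simp
    have h5 := mul_le_mul_of_nonneg_left (h3.trans key) (by positivity : 0 ≤ 4 * ρ ^ 2)
    rw [e]
    refine le_trans (le_of_eq ?_) h5
    ring
  have h6 := le_of_exp_neg_mul_le hσ hd hA0.le (by positivity : 0 ≤ ρ ^ 2 * φ) h4
  rw [le_div_iff₀ (by positivity)]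
  refine le_trans ?_ h6
  rw [mul_comm]
  gcongr
  linarith

theorem lap_log {u : E n → ℝ} {x : E n} (hu : ContDiffAt ℝ 2 u x) (h0 : 0 < u x) :
    lap (fun y => Real.log (u y)) x
      = lap u x / u x - ‖gradient (fun y => Real.log (u y)) x‖ ^ 2 := by
  have hjet : ∀ v, _ := fun v => ((hu.log h0.ne').hasJet v).unique
    ((hu.hasJet v).log (by simpa using h0.ne'))
  rw [← sum_sq_inner_single, lap_eq_sum_fderiv, lap_eq_sum_fderiv, Finset.sum_div,
    ← Finset.sum_sub_distrib]
  refine Finset.sum_congr rfl fun i _ => ?_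
  rw [inner_gradient_left, (hjet _).1, (hjet _).2]
  simp

/-- Gradient estimate for the logarithm of a positive solution. -/
theorem exists_norm_gradient_log_le (n : ℕ) (α : ℝ)
    (hαp : 2 < n → α < ((n : ℝ) + 2) / ((n : ℝ) - 2)) :
    ∃ C : ℝ, 0 < C ∧ ∀ (x₀ : E n) (R : ℝ), 0 < R → ∀ w : E n → ℝ,
      (∀ x ∈ ball x₀ (2 * R), ContDiffAt ℝ 2 w x) →
      (∀ x ∈ ball x₀ (2 * R), lap w x = -(‖gradient w x‖ ^ 2 + Real.exp ((α - 1) * w x))) →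
      ∀ x ∈ ball x₀ R, ‖gradient w x‖ ^ 2 ≤ C / R ^ 2 := by
  rcases le_or_gt (α - 1) 0 with ha | ha
  · exact norm_gradient_sq_le_of_nonpos n (le_max_left _ _) (le_max_right (n : ℝ) 2) ha
  refine norm_gradient_sq_le_of_pos n (le_max_left _ _) (le_max_right (n : ℝ) 2) ha ?_
  rcases le_or_gt n 2 with h | h
  · have : (n : ℝ) ≤ 2 := by exact_mod_cast h
    rw [max_eq_right this]
    norm_num
  · have h2 : (2 : ℝ) < n := by exact_mod_cast h
    have := hαp h
    rw [lt_div_iff₀ (by linarith)] at this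
    rw [max_eq_left h2.le]
    linarith

end Harnack

/-- curvature-free Harnack inequality for positive solutions of the
Lane–Emden equation `Δu + u^α = 0` with `α < p_S(n)`. -/
theorem stmt7 (n : ℕ) (hn : 0 < n) (α : ℝ)
    (hαp : 2 < n → α < ((n : ℝ) + 2) / ((n : ℝ) - 2)) :
    ∃ C : ℝ, 0 < C ∧
      ∀ (x₀ : E n) (R : ℝ), 0 < R →
        ∀ u : E n → ℝ, ContDiffOn ℝ 2 u (ball x₀ (2 * R)) →
          (∀ x ∈ ball x₀ (2 * R), 0 < u x) →
          (∀ x ∈ ball x₀ (2 * R), lap u x + u x ^ α = 0) →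
          ∀ x ∈ ball x₀ R, ∀ y ∈ ball x₀ R, u x ≤ C * u y := by
  obtain ⟨C, hC, hgrad⟩ := exists_norm_gradient_log_le n α hαp
  refine ⟨Real.exp (2 * √C), Real.exp_pos _, fun x₀ R hR u hu hpos heq x hx y hy => ?_⟩
  have hu' : ∀ z ∈ ball x₀ (2 * R), ContDiffAt ℝ 2 u z := fun z hz =>
    hu.contDiffAt (isOpen_ball.mem_nhds hz)
  have hw : ∀ z ∈ ball x₀ (2 * R), ContDiffAt ℝ 2 (fun y => Real.log (u y)) z := fun z hz =>
    (hu' z hz).log (hpos z hz).ne'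
  have hbound := hgrad x₀ R hR (fun y => Real.log (u y)) hw fun z hz => by
    have h1 : u z ^ α / u z = Real.exp ((α - 1) * Real.log (u z)) := by
      rw [← Real.rpow_sub_one (hpos z hz).ne', Real.rpow_def_of_pos (hpos z hz), mul_comm]
    rw [lap_log (hu' z hz) (hpos z hz), ← h1, eq_neg_of_add_eq_zero_left (heq z hz)]
    ring
  have hsub : ball x₀ R ⊆ ball x₀ (2 * R) := ball_subset_ball (by linarith)
  have hlip := (convex_ball x₀ R).norm_image_sub_le_of_norm_fderiv_le (𝕜 := ℝ) (C := √C / R)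
    (fun z hz => (hw z (hsub hz)).differentiableAt (by simp))
    (fun z hz => by
      have h1 : ‖fderiv ℝ (fun y => Real.log (u y)) z‖
          = ‖gradient (fun y => Real.log (u y)) z‖ := by
        rw [gradient, LinearIsometryEquiv.norm_map]
      rw [h1]
      refine le_of_sq_le_sq ?_ (by positivity)
      rw [div_pow, Real.sq_sqrt hC.le]
      exact hbound z hz) hy hx
  have hxy : ‖x - y‖ ≤ 2 * R := by
    have h1 := mem_ball.1 hx
    have h2 := mem_ball'.1 hy
    have := dist_triangle x x₀ y
    rw [← dist_eq_norm]
    linarith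
  have hlog : Real.log (u x) ≤ 2 * √C + Real.log (u y) := by
    have h1 : √C / R * ‖x - y‖ ≤ √C / R * (2 * R) := by gcongr
    have h2 : √C / R * (2 * R) = 2 * √C := by field_simp
    have h3 := (le_abs_self _).trans hlip
    linarith
  have := Real.exp_le_exp.2 hlog
  rwa [Real.exp_add, Real.exp_log (hpos x (hsub hx)), Real.exp_log (hpos y (hsub hy))] at this
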